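/- arXiv:1604.04642 — 3 statements merged into one kernel-verified Lean document; each statement's English description precedes it below -/
import Mathlib

section
/- Let λ > 0 be a real number, let p, q be nonzero complex numbers, let χ₂ ∈ ℂ, set χ₁ = p/(λq) and M = −2χ₂/p − χ₁²/p² − 1/(λq²), and assume Re(−q²·M) > 0. Let (r_k) and (s_k) be sequences of positive integers tending to infinity with r_k − λ·s_k bounded. Then, writing r = r_k and s = s_k, ∫_{−r^{−2/5}}^{r^{−2/5}} (q·e^{iθ})^{−s−1} · [1 − (χ₁(q·e^{iθ} − q) + χ₂(q·e^{iθ} − q)²)/p]^{−(r+1)} · i·q·e^{iθ} dθ = i·q^{−s}·√(2π/(−q²·M·r)) + o(|q|^{−s}·r^{−1/2}) as k → ∞, where the square root is the principal root. -/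
open Filter Asymptotics Topology

lemma taylor_aux (l c : ℂ) (hl : l ≠ 0) :
    (fun z : ℂ => Complex.log (1 - ((Complex.exp z - 1) / l + c * (Complex.exp z - 1) ^ 2))
      + z / l + (2 * c + 1 / l ^ 2 + 1 / l) * z ^ 2 / 2) =O[𝓝 0] fun z : ℂ => z ^ 3 := by
  have h3 : (fun z : ℂ => Complex.exp z - 1 - z - z ^ 2 / 2) =O[𝓝 0] fun z : ℂ => z ^ 3 := by
    have := Complex.exp_sub_sum_range_isBigO_pow 3
    refine this.congr_left fun z => ?_
    simp [Finset.sum_range_succ, Nat.factorial]; ring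
  have h2 : (fun z : ℂ => Complex.exp z - 1 - z) =O[𝓝 0] fun z : ℂ => z ^ 2 := by
    have := Complex.exp_sub_sum_range_isBigO_pow 2
    refine this.congr_left fun z => ?_
    simp [Finset.sum_range_succ, Nat.factorial]; ring
  have h1 : (fun z : ℂ => Complex.exp z - 1) =O[𝓝 0] fun z : ℂ => z := by
    have := Complex.exp_sub_sum_range_isBigO_pow 1
    refine (this.congr_left fun z => ?_).congr_right fun z => pow_one z
    simp
  have h1' : (fun z : ℂ => Complex.exp z - 1 + z) =O[𝓝 0] fun z : ℂ => z :=
    h1.add (isBigO_refl _ _)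
  have hsq : (fun z : ℂ => (Complex.exp z - 1) ^ 2 - z ^ 2) =O[𝓝 0] fun z : ℂ => z ^ 3 := by
    refine ((h2.mul h1').congr_left fun z => ?_).congr_right fun z => ?_ <;> ring
  have hw0 : Tendsto (fun z : ℂ => Complex.exp z - 1) (𝓝 0) (𝓝 0) := by
    have : Continuous fun z : ℂ => Complex.exp z - 1 := by fun_prop
    simpa using this.tendsto 0
  have hwb : (fun z : ℂ => Complex.exp z - 1) =O[𝓝 0] fun _ : ℂ => (1:ℂ) := hw0.isBigO_one ℂ
  have hcube : (fun z : ℂ => (Complex.exp z - 1) ^ 3) =O[𝓝 0] fun z : ℂ => z ^ 3 := h1.pow 3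
  have h4 : (fun z : ℂ => (Complex.exp z - 1) ^ 4) =O[𝓝 0] fun z : ℂ => z ^ 3 := by
    refine ((hcube.mul hwb).congr_left fun z => ?_).congr_right fun z => ?_ <;> ring
  have hwsq : (fun z : ℂ => (Complex.exp z - 1) ^ 2) =O[𝓝 0] fun z : ℂ => z := by
    refine ((h1.mul hwb).congr_left fun z => ?_).congr_right fun z => ?_ <;> ring
  have hu : (fun z : ℂ => -((Complex.exp z - 1) / l + c * (Complex.exp z - 1) ^ 2))
      =O[𝓝 0] fun z : ℂ => z := by
    have ha := (h1.const_mul_left (-1 / l)).add (hwsq.const_mul_left (-c))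
    refine ha.congr_left fun z => ?_
    ring
  have hu0 : Tendsto (fun z : ℂ => -((Complex.exp z - 1) / l + c * (Complex.exp z - 1) ^ 2))
      (𝓝 0) (𝓝 0) := by
    have : Continuous fun z : ℂ => -((Complex.exp z - 1) / l + c * (Complex.exp z - 1) ^ 2) := by
      fun_prop
    simpa using this.tendsto 0
  have hlog := ((Complex.log_sub_logTaylor_isBigO 2).comp_tendsto hu0).trans (hu.pow 3)
  have := (((hlog.add (h3.const_mul_left (-1 / l))).add
    (hsq.const_mul_left (-(c + 1 / (2 * l ^ 2))))).add (hcube.const_mul_left (-c / l))).add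
    (h4.const_mul_left (-c ^ 2 / 2))
  refine this.congr_left fun z => ?_
  simp only [Function.comp, Complex.logTaylor_succ, Complex.logTaylor_zero, Pi.add_apply]
  rw [← sub_eq_add_neg]
  simp
  field_simp
  ring

lemma cpow_half_aux (A : ℂ) (n : ℕ) (hn : 0 < n) :
    (2 * (Real.pi : ℂ) / (A * (n : ℂ))) ^ ((1 : ℂ) / 2)
      = (((n : ℝ) ^ (-(1:ℝ)/2) : ℝ) : ℂ) * (2 * (Real.pi : ℂ) / A) ^ ((1 : ℂ) / 2) := by
  have hn' : (0:ℝ) < n := by exact_mod_cast hn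
  rcases eq_or_ne A 0 with rfl | hA
  · simp
  have hx : 2 * (Real.pi : ℂ) / A ≠ 0 := by
    have := Real.pi_ne_zero
    simp [hA, this]
  have e : 2 * (Real.pi : ℂ) / (A * (n : ℂ)) = (((n:ℝ)⁻¹ : ℝ) : ℂ) * (2 * (Real.pi : ℂ) / A) := by
    push_cast
    field_simp
  have hi : (0:ℝ) < (n:ℝ)⁻¹ := inv_pos.2 hn'
  rw [e, Complex.cpow_def_of_ne_zero (mul_ne_zero (by exact_mod_cast hi.ne') hx),
    Complex.log_ofReal_mul hi hx, Complex.cpow_def_of_ne_zero hx, Real.rpow_def_of_pos hn',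
    Complex.ofReal_exp, ← Complex.exp_add, Real.log_inv]
  congr 1
  push_cast
  ring

lemma meas_aux (l c : ℂ) (s : ℂ) (x : ℝ) (n : ℕ) :
   Measurable (fun t : ℝ => Complex.exp (-s * (Complex.I * (t / x : ℝ))) *
    (1 - ((Complex.exp (Complex.I * (t / x : ℝ)) - 1) / l +
      c * (Complex.exp (Complex.I * (t / x : ℝ)) - 1) ^ 2)) ^ (-((n : ℤ) + 1))) := by
  have : (-((n : ℤ) + 1)) = - ((n+1 : ℕ) : ℤ) := by push_cast; ring
  simp only [this, zpow_neg, zpow_natCast]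
  fun_prop

lemma core_aux (lam : ℝ) (hlam : 0 < lam) (c A : ℂ)
    (hA : A = 2 * c + 1 / (lam : ℂ) ^ 2 + 1 / (lam : ℂ)) (hRe : 0 < A.re)
    (r s : ℕ → ℕ) (hr : Tendsto r atTop atTop)
    (hbound : ∃ C : ℝ, ∀ k, |(r k : ℝ) - lam * (s k : ℝ)| ≤ C) :
    Tendsto (fun k => ∫ t : ℝ in (-((r k : ℝ) ^ ((1:ℝ)/10)))..((r k : ℝ) ^ ((1:ℝ)/10)),
      Complex.exp (-(s k : ℂ) * (Complex.I * (t / √(r k) : ℝ))) *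
      (1 - ((Complex.exp (Complex.I * (t / √(r k) : ℝ)) - 1) / (lam : ℂ) +
      c * (Complex.exp (Complex.I * (t / √(r k) : ℝ)) - 1) ^ 2)) ^ (-((r k : ℤ) + 1)))
      atTop (𝓝 ((2 * (Real.pi : ℂ) / A) ^ ((1 : ℂ) / 2))) := by
  have hl : (lam : ℂ) ≠ 0 := by exact_mod_cast hlam.ne'
  obtain ⟨C, hC⟩ := hbound
  have hrR : Tendsto (fun k => (r k : ℝ)) atTop atTop := tendsto_natCast_atTop_atTop.comp hr
  have hsq : Tendsto (fun k => √(r k : ℝ)) atTop atTop := Real.tendsto_sqrt_atTop.comp hrR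
  set B : ℝ → ℂ := fun θ => 1 - ((Complex.exp (Complex.I * (θ : ℝ)) - 1) / (lam : ℂ) +
      c * (Complex.exp (Complex.I * (θ : ℝ)) - 1) ^ 2) with hB
  set H : ℝ → ℂ := fun θ => Complex.log (B θ) + (Complex.I * θ) / lam + A * (Complex.I * θ) ^ 2 / 2
    with hH
  have hHo : H =o[𝓝 0] fun θ : ℝ => θ ^ 2 := by
    have h0 : Tendsto (fun θ : ℝ => Complex.I * (θ : ℂ)) (𝓝 0) (𝓝 0) := by
      have : Continuous fun θ : ℝ => Complex.I * (θ : ℂ) := by fun_prop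
      simpa using this.tendsto 0
    have h1 := (taylor_aux (lam : ℂ) c hl).comp_tendsto h0
    have h2 : H =O[𝓝 0] fun θ : ℝ => θ ^ 3 := by
      refine IsBigO.trans (h1.congr_left fun θ => ?_) (IsBigO.of_bound 1 ?_)
      · simp [hH, hB, hA]
      · exact Eventually.of_forall fun θ => by simp
    exact h2.trans_isLittleO (isLittleO_pow_pow (by norm_num))
  have hB0 : ∀ᶠ θ in 𝓝 (0:ℝ), B θ ≠ 0 := by
    have : Continuous B := by fun_prop
    refine (this.tendsto 0).eventually_ne ?_
    simp [hB]
  -- exponential form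
  have hexp : ∀ θ : ℝ, B θ ≠ 0 → ∀ n m : ℕ,
      Complex.exp (-(m : ℂ) * (Complex.I * (θ : ℝ))) * (B θ) ^ (-((n : ℤ) + 1)) =
      Complex.exp ((((n : ℝ) / lam - m) * θ : ℝ) * Complex.I +
        (((θ / lam : ℝ) : ℂ) * Complex.I - A * θ ^ 2 / 2 - H θ) - (n * θ ^ 2 : ℝ) * A / 2
          - n * H θ) := by
    intro θ hθ n m
    have e1 : (B θ) ^ (-((n : ℤ) + 1)) = Complex.exp (-((n : ℂ) + 1) * Complex.log (B θ)) := by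
      have : (-((n : ℂ) + 1)) = ((-((n : ℤ) + 1) : ℤ) : ℂ) := by push_cast; ring
      rw [this, Complex.exp_int_mul, Complex.exp_log hθ]
    rw [e1, ← Complex.exp_add]
    congr 1
    simp only [hH]
    push_cast
    have := Complex.I_sq
    field_simp
    ring_nf
    simp only [Complex.I_sq]
    ring
  have hnear : ∀ᶠ θ in 𝓝 (0:ℝ), B θ ≠ 0 ∧ ‖H θ‖ ≤ A.re / 4 * θ ^ 2 := by
    filter_upwards [hB0, hHo.bound (show (0:ℝ) < A.re / 4 by positivity)] with θ h1 h2
    refine ⟨h1, ?_⟩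
    simpa using h2
  obtain ⟨δ, hδ, hball⟩ := Metric.eventually_nhds_iff.1 hnear
  -- window shrinks
  have hwin : ∀ᶠ k in atTop, 0 < r k ∧ (r k : ℝ) ^ ((1:ℝ)/10) / √(r k) < δ := by
    have h1 : Tendsto (fun x : ℝ => x ^ (-(2/5:ℝ))) atTop (𝓝 0) :=
      tendsto_rpow_neg_atTop (by norm_num)
    filter_upwards [(h1.comp hrR).eventually (gt_mem_nhds hδ), hr.eventually_gt_atTop 0]
      with k hk hk0
    refine ⟨hk0, ?_⟩
    have : (0:ℝ) < r k := by exact_mod_cast hk0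
    rw [Real.sqrt_eq_rpow, ← Real.rpow_sub this]
    have e : (1:ℝ) / 10 - 1 / 2 = -(2/5) := by norm_num
    rw [e]
    exact hk
  have hgauss := integral_gaussian_complex (b := A / 2) (by simpa using hRe)
  have e2 : (Real.pi : ℂ) / (A / 2) = 2 * Real.pi / A := by
    rw [div_div_eq_mul_div, mul_comm]
  rw [e2] at hgauss
  rw [← hgauss]
  have hint : ∀ k, (∫ t : ℝ in (-((r k : ℝ) ^ ((1:ℝ)/10)))..((r k : ℝ) ^ ((1:ℝ)/10)),
      Complex.exp (-(s k : ℂ) * (Complex.I * (t / √(r k) : ℝ))) *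
        B (t / √(r k)) ^ (-((r k : ℤ) + 1))) = ∫ t : ℝ,
      (Set.Ioc (-((r k : ℝ) ^ ((1:ℝ)/10))) ((r k : ℝ) ^ ((1:ℝ)/10))).indicator (fun t : ℝ =>
      Complex.exp (-(s k : ℂ) * (Complex.I * (t / √(r k) : ℝ))) *
        B (t / √(r k)) ^ (-((r k : ℤ) + 1))) t := by
    intro k
    have : (0:ℝ) ≤ (r k : ℝ) ^ ((1:ℝ)/10) := by positivity
    rw [intervalIntegral.integral_of_le (by linarith),
      MeasureTheory.integral_indicator measurableSet_Ioc]
  change Tendsto (fun k => ∫ t : ℝ in (-((r k : ℝ) ^ ((1:ℝ)/10)))..((r k : ℝ) ^ ((1:ℝ)/10)),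
      Complex.exp (-(s k : ℂ) * (Complex.I * (t / √(r k) : ℝ))) *
        B (t / √(r k)) ^ (-((r k : ℤ) + 1))) _ _
  simp only [hint]
  refine MeasureTheory.tendsto_integral_filter_of_dominated_convergence
    (fun t : ℝ => Real.exp (-(A.re / 4) * t ^ 2)) ?_ ?_
    (integrable_exp_neg_mul_sq (by positivity)) ?_
  · refine Eventually.of_forall fun k => ?_
    exact ((meas_aux lam c (s k) (√(r k)) (r k)).indicator measurableSet_Ioc).aestronglyMeasurable
  · filter_upwards [hwin] with k hk
    refine Eventually.of_forall fun t => ?_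
    by_cases ht : t ∈ Set.Ioc (-((r k : ℝ) ^ ((1:ℝ)/10))) ((r k : ℝ) ^ ((1:ℝ)/10))
    · rw [Set.indicator_of_mem ht]
      have hrk : (0:ℝ) < r k := by exact_mod_cast hk.1
      have hsk : 0 < √(r k : ℝ) := Real.sqrt_pos.2 hrk
      have hd : dist (t / √(r k)) 0 < δ := by
        rw [Real.dist_eq, sub_zero, abs_div, abs_of_pos hsk]
        refine lt_of_le_of_lt ?_ hk.2
        gcongr
        exact abs_le.2 ⟨ht.1.le, ht.2⟩
      obtain ⟨hb, hh⟩ := hball hd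
      rw [hexp _ hb, Complex.norm_exp]
      refine Real.exp_le_exp.2 ?_
      have ht2 : (r k : ℝ) * (t / √(r k)) ^ 2 = t ^ 2 := by
        rw [div_pow, Real.sq_sqrt hrk.le]; field_simp
      have hre : -‖H (t / √(r k))‖ ≤ (H (t / √(r k))).re :=
        neg_le_of_abs_le (Complex.abs_re_le_norm _)
      rw [ht2]
      set θ := t / √(r k)
      have e3 : (A * (θ : ℂ) ^ 2 / 2).re = A.re * θ ^ 2 / 2 := by
        rw [← Complex.ofReal_pow, mul_comm A, mul_div_assoc, Complex.re_ofReal_mul]; simp; ring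
      have e4 : (((t ^ 2 : ℝ) : ℂ) * A / 2).re = t ^ 2 * A.re / 2 := by
        rw [mul_div_assoc, Complex.re_ofReal_mul]; simp [mul_div_assoc]
      have e5 : ((r k : ℂ) * H θ).re = r k * (H θ).re := by
        rw [← Complex.ofReal_natCast, Complex.re_ofReal_mul]
      simp only [Complex.add_re, Complex.sub_re, Complex.re_ofReal_mul, Complex.I_re, e3, e4, e5,
        mul_zero]
      have h6 : -(r k : ℝ) * (H θ).re ≤ A.re / 4 * t ^ 2 := by
        rw [← ht2]; nlinarith
      nlinarith [mul_nonneg hRe.le (sq_nonneg θ)]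
    · rw [Set.indicator_of_notMem ht]
      simp [Real.exp_nonneg]
  · refine Eventually.of_forall fun t => ?_
    have hθ : Tendsto (fun k => t / √(r k : ℝ)) atTop (𝓝 0) := hsq.const_div_atTop t
    have hR : Tendsto (fun k => (r k : ℝ) ^ ((1:ℝ)/10)) atTop atTop :=
      (tendsto_rpow_atTop (by norm_num)).comp hrR
    have hlim : Tendsto (fun k => Complex.exp
        ((((r k : ℝ) / lam - s k) * (t / √(r k : ℝ)) : ℝ) * Complex.I +
        (((t / √(r k : ℝ) / lam : ℝ) : ℂ) * Complex.I - A * (t / √(r k : ℝ) : ℝ) ^ 2 / 2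
          - H (t / √(r k : ℝ))) - (t ^ 2 : ℝ) * A / 2
          - r k * H (t / √(r k : ℝ)))) atTop (𝓝 (Complex.exp (-(A / 2) * (t:ℂ) ^ 2))) := by
      refine Tendsto.cexp ?_
      have a1 : Tendsto (fun k => ((((r k : ℝ) / lam - s k) * (t / √(r k : ℝ)) : ℝ) : ℂ))
          atTop (𝓝 0) := by
        rw [← Complex.ofReal_zero]
        refine (Complex.continuous_ofReal.tendsto 0).comp ?_
        refine bdd_le_mul_tendsto_zero' (C / lam) (Eventually.of_forall fun k => ?_) hθ
        have : (r k : ℝ) / lam - s k = ((r k : ℝ) - lam * s k) / lam := by field_simp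
        rw [this, abs_div, abs_of_pos hlam]
        gcongr
        exact hC k
      have hH0 : Tendsto H (𝓝 0) (𝓝 0) := by
        refine hHo.isBigO.trans_tendsto ?_
        have : Continuous fun θ : ℝ => θ ^ 2 := by fun_prop
        simpa using this.tendsto 0
      have a2 : Tendsto (fun k => ((t / √(r k : ℝ) / lam : ℝ) : ℂ) * Complex.I
          - A * (t / √(r k : ℝ) : ℝ) ^ 2 / 2) atTop (𝓝 0) := by
        have : Continuous fun θ : ℝ => ((θ / lam : ℝ) : ℂ) * Complex.I - A * (θ : ℂ) ^ 2 / 2 := by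
          fun_prop
        have h := (this.tendsto 0).comp hθ
        simp only [Complex.ofReal_zero, zero_div, zero_mul, ne_eq, OfNat.ofNat_ne_zero,
          not_false_eq_true, zero_pow, mul_zero, sub_self] at h
        exact h
      have a3 : Tendsto (fun k => (r k : ℂ) * H (t / √(r k : ℝ))) atTop (𝓝 0) := by
        have h1 := hHo.comp_tendsto hθ
        have h2 : (fun k => (r k : ℂ) * H (t / √(r k : ℝ))) =o[atTop] fun k =>
            (r k : ℝ) * (t / √(r k : ℝ)) ^ 2 := by
          refine IsBigO.mul_isLittleO ?_ h1
          exact IsBigO.of_norm_eventuallyLE (Eventually.of_forall fun k => by simp)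
        have h3 : (fun k => (r k : ℝ) * (t / √(r k : ℝ)) ^ 2) =O[atTop] fun _ => (1:ℝ) := by
          refine IsBigO.of_bound (t ^ 2) ?_
          filter_upwards [hr.eventually_gt_atTop 0] with k hk
          have hrk : (0:ℝ) < r k := by exact_mod_cast hk
          have ht2 : (r k : ℝ) * (t / √(r k)) ^ 2 = t ^ 2 := by
            rw [div_pow, Real.sq_sqrt hrk.le]; field_simp
          rw [ht2]; simp
        exact (isLittleO_one_iff ℝ).1 (h2.trans_isBigO h3)
      have a4 := (((a1.mul_const Complex.I).add (a2.sub (hH0.comp hθ))).sub_const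
        (((t ^ 2 : ℝ) : ℂ) * A / 2)).sub a3
      have e : 0 * Complex.I + (0 - 0) - ((t ^ 2 : ℝ) : ℂ) * A / 2 - 0 = -(A / 2) * (t:ℂ) ^ 2 := by
        push_cast
        ring
      rw [e] at a4
      exact a4
    refine hlim.congr' ?_
    filter_upwards [hr.eventually_gt_atTop 0, hR.eventually_gt_atTop |t|, hθ.eventually hB0]
      with k hk ht hb
    have hrk : (0:ℝ) < r k := by exact_mod_cast hk
    have ht2 : (r k : ℝ) * (t / √(r k)) ^ 2 = t ^ 2 := by
      rw [div_pow, Real.sq_sqrt hrk.le]; field_simp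
    have htm := abs_lt.1 ht
    have hmem : t ∈ Set.Ioc (-((r k : ℝ) ^ ((1:ℝ)/10))) ((r k : ℝ) ^ ((1:ℝ)/10)) :=
      ⟨htm.1, htm.2.le⟩
    rw [Set.indicator_of_mem hmem, hexp _ hb, ht2]

/-- the v-integral over the arc `V = {q·e^{iθ} : |θ| ≤ r^{−2/5}}` satisfies
`∫_V v^{−s−1}[1 − (χ₁(v−q) + χ₂(v−q)²)/p]^{−r−1} dv = i·q^{−s}·√(2π/(−q²·M·r))
+ o(|q|^{−s}·r^{−1/2})` along integer sequences `r, s → ∞` with `r − λs` bounded. -/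
theorem v_integral_asymptotics (lam : ℝ) (hlam : 0 < lam)
    (p q χ₂ : ℂ) (hp : p ≠ 0) (hq : q ≠ 0) (χ₁ M : ℂ)
    (hχ₁ : χ₁ = p / ((lam : ℂ) * q))
    (hM : M = -2 * χ₂ / p - χ₁ ^ 2 / p ^ 2 - 1 / ((lam : ℂ) * q ^ 2))
    (hRe : 0 < (-q ^ 2 * M).re)
    (r s : ℕ → ℕ) (hr : Tendsto r atTop atTop) (hs : Tendsto s atTop atTop)
    (hbound : ∃ C : ℝ, ∀ k, |(r k : ℝ) - lam * (s k : ℝ)| ≤ C) :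
    (fun k =>
        (∫ θ : ℝ in (-((r k : ℝ) ^ (-(2:ℝ)/5)))..((r k : ℝ) ^ (-(2:ℝ)/5)),
          (q * Complex.exp (Complex.I * (θ : ℂ))) ^ (-(s k : ℤ) - 1) *
            (1 - (χ₁ * (q * Complex.exp (Complex.I * (θ : ℂ)) - q)
                + χ₂ * (q * Complex.exp (Complex.I * (θ : ℂ)) - q) ^ 2) / p)
              ^ (-((r k : ℤ) + 1)) *
            (Complex.I * q * Complex.exp (Complex.I * (θ : ℂ))))
        - Complex.I * q ^ (-(s k : ℤ)) *
            ((2 * (Real.pi : ℂ) / (-q ^ 2 * M * (r k : ℂ))) ^ ((1 : ℂ) / 2)))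
      =o[atTop] fun k => ‖q‖ ^ (-(s k : ℤ)) * (r k : ℝ) ^ (-(1:ℝ)/2) := by
  have hl : (lam : ℂ) ≠ 0 := by exact_mod_cast hlam.ne'
  have hA : -q ^ 2 * M = 2 * (χ₂ * q ^ 2 / p) + 1 / (lam : ℂ) ^ 2 + 1 / (lam : ℂ) := by
    rw [hM, hχ₁]
    field_simp
    ring
  have hcore := core_aux lam hlam (χ₂ * q ^ 2 / p) (-q ^ 2 * M) hA hRe r s hr hbound
  set A := -q ^ 2 * M
  set J := (2 * (Real.pi : ℂ) / A) ^ ((1 : ℂ) / 2)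
  set F : ℕ → ℂ := fun k => ∫ t : ℝ in (-((r k : ℝ) ^ ((1:ℝ)/10)))..((r k : ℝ) ^ ((1:ℝ)/10)),
      Complex.exp (-(s k : ℂ) * (Complex.I * (t / √(r k) : ℝ))) *
      (1 - ((Complex.exp (Complex.I * (t / √(r k) : ℝ)) - 1) / (lam : ℂ) +
      (χ₂ * q ^ 2 / p) * (Complex.exp (Complex.I * (t / √(r k) : ℝ)) - 1) ^ 2)) ^ (-((r k : ℤ) + 1))
    with hF
  have hzero : (fun k => F k - J) =o[atTop] fun _ => (1 : ℝ) :=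
    (isLittleO_one_iff ℝ).2 (by simpa using hcore.sub_const J)
  have hmain : (fun k => (Complex.I * q ^ (-(s k : ℤ)) * (((r k : ℝ) ^ (-(1:ℝ)/2) : ℝ) : ℂ)) *
      (F k - J)) =o[atTop] fun k => (‖q‖ ^ (-(s k : ℤ)) * (r k : ℝ) ^ (-(1:ℝ)/2)) * 1 := by
    refine IsBigO.mul_isLittleO (IsBigO.of_norm_eventuallyLE (Eventually.of_forall fun k => ?_)) hzero
    have : (0:ℝ) ≤ (r k : ℝ) ^ (-(1:ℝ)/2) := by positivity
    simp only [norm_mul, Complex.norm_I, one_mul, norm_zpow, Complex.norm_real, Real.norm_eq_abs,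
      abs_of_nonneg this]
    exact le_rfl
  simp only [mul_one] at hmain
  refine hmain.congr' ?_ EventuallyEq.rfl
  filter_upwards [hr.eventually_gt_atTop 0] with k hk
  have hrk : (0:ℝ) < r k := by exact_mod_cast hk
  have hsk : 0 < √(r k : ℝ) := Real.sqrt_pos.2 hrk
  rw [cpow_half_aux A (r k) hk, mul_sub, ← mul_assoc (Complex.I * q ^ (-(s k : ℤ)))]
  congr 1
  have hR : (r k : ℝ) ^ (-(2:ℝ)/5) = (r k : ℝ) ^ ((1:ℝ)/10) / √(r k) := by
    rw [Real.sqrt_eq_rpow, ← Real.rpow_sub hrk]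
    norm_num
  have hinv : (r k : ℝ) ^ (-(1:ℝ)/2) = (√(r k))⁻¹ := by
    rw [Real.sqrt_eq_rpow, ← Real.rpow_neg hrk.le]
    norm_num
  have hsub := intervalIntegral.integral_comp_div (a := -((r k : ℝ) ^ ((1:ℝ)/10)))
    (b := (r k : ℝ) ^ ((1:ℝ)/10)) (fun θ : ℝ => Complex.exp (-(s k : ℂ) * (Complex.I * θ)) *
      (1 - ((Complex.exp (Complex.I * θ) - 1) / (lam : ℂ) +
      (χ₂ * q ^ 2 / p) * (Complex.exp (Complex.I * θ) - 1) ^ 2)) ^ (-((r k : ℤ) + 1))) hsk.ne'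
  rw [neg_div, ← hR] at hsub
  have hFk : F k = _ := hsub
  rw [hFk, hinv, Complex.real_smul, Complex.ofReal_inv, mul_assoc, 
    inv_mul_cancel_left₀ (by exact_mod_cast hsk.ne'), ← intervalIntegral.integral_const_mul]
  refine intervalIntegral.integral_congr fun θ _ => ?_
  have hb : 1 - (χ₁ * (q * Complex.exp (Complex.I * (θ : ℂ)) - q)
                + χ₂ * (q * Complex.exp (Complex.I * (θ : ℂ)) - q) ^ 2) / p
      = 1 - ((Complex.exp (Complex.I * θ) - 1) / (lam : ℂ) +
      (χ₂ * q ^ 2 / p) * (Complex.exp (Complex.I * θ) - 1) ^ 2) := by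
    rw [hχ₁]
    field_simp
  have he : Complex.exp (Complex.I * (θ : ℂ)) ≠ 0 := Complex.exp_ne_zero _
  have hx : Complex.exp (-(s k : ℂ) * (Complex.I * θ)) =
      Complex.exp (Complex.I * θ) ^ (-(s k : ℤ)) := by
    rw [← Complex.exp_int_mul]; push_cast; rfl
  simp only [hb, hx]
  rw [zpow_sub_one₀ (mul_ne_zero hq he), mul_zpow]
  field_simp
end

section
/- Let H(x,y) = 1 − 2x(1+y) − x²(1−y)² and G(x,y) = 1 − x(1+y), and let F be the function of two complex variables analytic on a neighborhood of the origin with F(0,0) = 1 and F(x,y)²·H(x,y) = G(x,y)² there (so F = G/√H with the branch √H = 1 at the origin); let a_{r,s} denote the Taylor coefficients of F at (0,0). Then a_{2s,s} ~ 4^{2s}/(2s·π·√3) as s → ∞. Moreover, for the branch of H^{−1/2} analytic near the origin with value 1 at the origin, its Taylor coefficients b_{r,s} satisfy b_{2s,s} ~ 2·4^{2s}/(2s·π·√3) as s → ∞. -/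
open Filter Topology

def PSRep (f : ℂ → ℂ) (φ : PowerSeries ℂ) : Prop :=
  ∀ᶠ z in 𝓝 (0:ℂ), HasSum (fun n => PowerSeries.coeff n φ * z ^ n) (f z)

lemma PSRep.unique {f g : ℂ → ℂ} {φ ψ : PowerSeries ℂ} (hf : PSRep f φ) (hg : PSRep g ψ)
    (h : f =ᶠ[𝓝 0] g) : φ = ψ := by
  have key : ∀ {f : ℂ → ℂ} {φ : PowerSeries ℂ}, PSRep f φ →
      HasFPowerSeriesAt f (FormalMultilinearSeries.ofScalars ℂ (fun n => PowerSeries.coeff n φ)) 0 := by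
    intro f φ hf
    rw [hasFPowerSeriesAt_iff]
    filter_upwards [hf] with z hz
    simpa [FormalMultilinearSeries.coeff_ofScalars, mul_comm] using hz
  have := (key hf).eq_formalMultilinearSeries_of_eventually (key hg) h
  ext n
  have h2 := congrArg (fun p => FormalMultilinearSeries.coeff p n) this
  simpa [FormalMultilinearSeries.coeff_ofScalars] using h2

lemma PSRep.mul {f g : ℂ → ℂ} {φ ψ : PowerSeries ℂ} (hf : PSRep f φ) (hg : PSRep g ψ) :
    PSRep (fun z => f z * g z) (φ * ψ) := by
  filter_upwards [hf, hg] with z h1 h2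
  have n1 := h1.summable.norm
  have n2 := h2.summable.norm
  have e : (fun n => PowerSeries.coeff n (φ * ψ) * z ^ n) = fun n =>
      ∑ kl ∈ Finset.HasAntidiagonal.antidiagonal n, (PowerSeries.coeff kl.1 φ * z ^ kl.1) *
        (PowerSeries.coeff kl.2 ψ * z ^ kl.2) := by
    ext n
    rw [PowerSeries.coeff_mul, Finset.sum_mul]
    refine Finset.sum_congr rfl fun kl hkl => ?_
    rw [← Finset.HasAntidiagonal.mem_antidiagonal.mp hkl, pow_add]; ring
  rw [e, ← h1.tsum_eq, ← h2.tsum_eq,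
    tsum_mul_tsum_eq_tsum_sum_antidiagonal_of_summable_norm n1 n2]
  exact (summable_norm_sum_mul_antidiagonal_of_summable_norm n1 n2).of_norm.hasSum

lemma PSRep.poly (p : Polynomial ℂ) : PSRep (fun z => p.eval z) (p : PowerSeries ℂ) := by
  refine Eventually.of_forall fun z => ?_
  simp only [Polynomial.coeff_coe]
  rw [Polynomial.eval_eq_sum_range]
  apply hasSum_sum_of_ne_finset_zero
  intro n hn
  rw [Polynomial.coeff_eq_zero_of_natDegree_lt (by simpa using hn), zero_mul]

lemma PSRep.of_tsum {f : ℂ → ℂ} {c : ℕ → ℂ} {x₀ : ℂ} (hx0 : x₀ ≠ 0)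
    (hs : Summable fun n => c n * x₀ ^ n)
    (h : ∀ᶠ x in 𝓝 (0:ℂ), f x = ∑' n, c n * x ^ n) : PSRep f (PowerSeries.mk c) := by
  have hlt : ∀ᶠ x in 𝓝 (0:ℂ), ‖x‖ < ‖x₀‖ := by
    have := Metric.ball_mem_nhds (0:ℂ) (norm_pos_iff.mpr hx0)
    filter_upwards [this] with x hx using by simpa using hx
  filter_upwards [h, hlt] with x hx hl
  rw [hx]
  simp only [PowerSeries.coeff_mk]
  apply Summable.hasSum
  obtain ⟨C, hC⟩ := hs.tendsto_atTop_zero.norm.bddAbove_range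
  have hp : 0 < ‖x₀‖ := norm_pos_iff.mpr hx0
  refine Summable.of_norm_bounded (g := fun n => C * (‖x‖ / ‖x₀‖) ^ n)
    ((summable_geometric_of_lt_one (by positivity) ((div_lt_one hp).mpr hl)).mul_left C) ?_
  intro n
  have : ‖c n * x₀ ^ n‖ ≤ C := hC ⟨n, rfl⟩
  calc ‖c n * x ^ n‖ = ‖c n * x₀ ^ n‖ * (‖x‖ / ‖x₀‖) ^ n := by
        rw [norm_mul, norm_mul, norm_pow, norm_pow, div_pow]; field_simp
    _ ≤ _ := by gcongr

lemma coeff_of_tsum {f : ℂ → ℂ} {φ : PowerSeries ℂ} {c : ℕ → ℂ} (hφ : φ ≠ 0) (hf : PSRep f φ)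
    (h : ∀ᶠ x in 𝓝 (0:ℂ), f x = ∑' n, c n * x ^ n) (n : ℕ) : c n = PowerSeries.coeff n φ := by
  have : ∃ x, x ≠ 0 ∧ f x = ∑' n, c n * x ^ n ∧ f x ≠ 0 := by
    by_contra hcon
    push Not at hcon
    have e : (fun z => Polynomial.eval z Polynomial.X * f z) =ᶠ[𝓝 0]
        fun z => Polynomial.eval z 0 := by
      filter_upwards [h] with x hx
      by_cases h0 : x = 0
      · simp [h0]
      · simp [hcon x h0 hx]
    have := ((PSRep.poly Polynomial.X).mul hf).unique (PSRep.poly 0) e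
    simp [hφ, PowerSeries.X_ne_zero] at this
  obtain ⟨x₀, h0, h1, h2⟩ := this
  have hs : Summable fun n => c n * x₀ ^ n := by
    by_contra hns
    exact h2 (h1.trans (tsum_eq_zero_of_not_summable hns))
  have := (PSRep.of_tsum h0 hs h).unique hf (EventuallyEq.refl _ _)
  rw [← this, PowerSeries.coeff_mk]

/-- polynomials -/
noncomputable def PP : ℕ → Polynomial ℂ
  | 0 => 1
  | 1 => 1 + Polynomial.X
  | (n+2) => Polynomial.C (1 / ((n:ℂ)+2)) * (Polynomial.C (2*(n:ℂ)+3) * (1 + Polynomial.X) * PP (n+1)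
      + Polynomial.C ((n:ℂ)+1) * (1 - Polynomial.X)^2 * PP n)

lemma PP_rec (n : ℕ) (y : ℂ) : ((n:ℂ)+2) * (PP (n+2)).eval y =
    (2*(n:ℂ)+3) * (1+y) * (PP (n+1)).eval y + ((n:ℂ)+1) * (1-y)^2 * (PP n).eval y := by
  have : (n:ℂ)+2 ≠ 0 := by exact_mod_cast (by omega : n + 2 ≠ 0)
  simp [PP]
  field_simp

lemma rec_unique {m k : ℕ → ℂ} {u d : ℂ} (h0 : m 0 = k 0) (h1 : m 1 = k 1)
    (hm : ∀ n : ℕ, ((n:ℂ)+2) * m (n+2) = (2*(n:ℂ)+3) * u * m (n+1) + ((n:ℂ)+1) * d * m n)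
    (hk : ∀ n : ℕ, ((n:ℂ)+2) * k (n+2) = (2*(n:ℂ)+3) * u * k (n+1) + ((n:ℂ)+1) * d * k n)
    (n : ℕ) : m n = k n := by
  induction n using Nat.strong_induction_on with
  | _ n ih =>
    match n with
    | 0 => exact h0
    | 1 => exact h1
    | n+2 =>
      have : (n:ℂ)+2 ≠ 0 := by exact_mod_cast (by omega : n + 2 ≠ 0)
      apply mul_left_cancel₀ this
      rw [hm, hk, ih n (by omega), ih (n+1) (by omega)]

open PowerSeries in
lemma ps_rec {φ : PowerSeries ℂ} {u d : ℂ} (h0 : coeff 0 φ = 1)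
    (h : φ ^ 2 * (1 - C (2*u) * X - C d * X^2) = 1) :
    coeff 1 φ = u ∧ ∀ n : ℕ, ((n:ℂ)+2) * coeff (n+2) φ =
      (2*(n:ℂ)+3) * u * coeff (n+1) φ + ((n:ℂ)+1) * d * coeff n φ := by
  have hφ : φ ≠ 0 := by rintro rfl; simp at h0
  have hd := congrArg (PowerSeries.derivative ℂ) h
  have e : derivative ℂ φ - C (2*u) * (X * derivative ℂ φ) - C d * (X^2 * derivative ℂ φ)
      = C u * φ + C d * (X * φ) := by
    have h2 : (2 * φ) * (derivative ℂ φ - C (2*u) * (X * derivative ℂ φ) - C d * (X^2 * derivative ℂ φ)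
      - (C u * φ + C d * (X * φ))) = 0 := by
      simp [Derivation.leibniz, Derivation.leibniz_pow, PowerSeries.derivative_C, PowerSeries.derivative_X] at hd
      have c2 : (C (2:ℂ) : PowerSeries ℂ) = 2 := map_ofNat C 2
      rw [map_mul, c2]; rw [c2] at hd
      linear_combination hd
    have h3 : (2 * φ) ≠ 0 := by
      refine mul_ne_zero ?_ hφ
      rw [← map_ofNat C 2]
      intro hc
      have := congrArg (coeff 0) hc
      simp at this
    have := (mul_eq_zero.mp h2).resolve_left h3
    linear_combination this
  constructor
  · have := congrArg (coeff 0) e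
    rw [map_sub, map_sub, map_add, pow_two, mul_assoc, coeff_C_mul, coeff_C_mul, coeff_C_mul,
      coeff_C_mul, coeff_zero_X_mul, coeff_zero_X_mul, coeff_zero_X_mul, coeff_derivative, h0] at this
    simpa using this
  · intro n
    have := congrArg (coeff (n+1)) e
    have hx : coeff (n+1) (X^2 * derivative ℂ φ) = n * coeff n φ := by
      cases n with
      | zero => 
        rw [pow_two, mul_assoc, coeff_succ_X_mul]; simp
      | succ k =>
        rw [pow_two, mul_assoc, coeff_succ_X_mul, coeff_succ_X_mul, coeff_derivative]
        push_cast; ring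
    simp only [map_sub, map_add, coeff_C_mul, coeff_succ_X_mul, coeff_derivative, hx] at this
    push_cast at this
    linear_combination this
noncomputable def JJ (z : ℝ × ℝ) : ℂ :=
  Complex.exp (-(Complex.I * z.2)) + 2 * Complex.cos z.1 + Complex.cos (2 * z.1) * Complex.exp (Complex.I * z.2)

lemma JJ_continuous : Continuous JJ := by unfold JJ; fun_prop

/-- constant-term recurrence -/
lemma M_rec (u v : ℂ) (L : ℝ → ℂ)
    (hL : L = fun φ : ℝ => Complex.exp (-(Complex.I * φ)) + u + v * Complex.exp (Complex.I * φ)) (n : ℕ) :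
    (∫ φ in (-Real.pi)..Real.pi, L φ ^ 0) = 2 * Real.pi ∧
    (∫ φ in (-Real.pi)..Real.pi, L φ ^ 1) = u * (2 * Real.pi) ∧
    ((n:ℂ)+2) * (∫ φ in (-Real.pi)..Real.pi, L φ ^ (n+2)) =
      (2*(n:ℂ)+3) * u * (∫ φ in (-Real.pi)..Real.pi, L φ ^ (n+1))
       + ((n:ℂ)+1) * (4*v-u^2) * (∫ φ in (-Real.pi)..Real.pi, L φ ^ n) := by
  have hc : Continuous L := by rw [hL]; fun_prop
  set D : ℝ → ℂ := fun φ : ℝ => Complex.I * (v * Complex.exp (Complex.I * φ) - Complex.exp (-(Complex.I * φ))) with hD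
  have hDc : Continuous D := by rw [hD]; fun_prop
  have e1 : ∀ x : ℝ, HasDerivAt (fun φ : ℝ => Complex.exp (Complex.I * φ)) (Complex.I * Complex.exp (Complex.I * x)) x := by
    intro x
    have := (((hasDerivAt_id (x:ℂ)).const_mul Complex.I).cexp).comp_ofReal
    simpa [mul_comm] using this
  have e2 : ∀ x : ℝ, HasDerivAt (fun φ : ℝ => Complex.exp (-(Complex.I * φ))) (-Complex.I * Complex.exp (-(Complex.I * x))) x := by
    intro x
    have := (((hasDerivAt_id (x:ℂ)).const_mul Complex.I).neg.cexp).comp_ofReal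
    simpa [mul_comm] using this
  have dL : ∀ x, HasDerivAt L (D x) x := by
    intro x
    rw [hL]
    have := ((e2 x).add_const u).add ((e1 x).const_mul v)
    refine this.congr_deriv ?_
    simp only [hD]; ring
  have dD : ∀ x, HasDerivAt D (-(L x - u)) x := by
    intro x
    have := (((e1 x).const_mul v).sub (e2 x)).const_mul Complex.I
    refine this.congr_deriv ?_
    simp only [hL]; linear_combination ((v * Complex.exp (Complex.I * x)) + Complex.exp (-(Complex.I * x))) * Complex.I_sq
  have hper : L Real.pi = L (-Real.pi) ∧ D Real.pi = D (-Real.pi) := by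
    have a1 : Complex.exp (Complex.I * Real.pi) = -1 := by rw [mul_comm]; exact Complex.exp_pi_mul_I
    have a2 : Complex.exp (-(Complex.I * Real.pi)) = -1 := by rw [Complex.exp_neg, a1]; norm_num
    simp [hL, hD, a1, a2]
  have D2 : ∀ x, D x ^ 2 = 4 * v - (L x - u)^2 := by
    intro x
    have : Complex.exp (Complex.I * x) * Complex.exp (-(Complex.I * x)) = 1 := by
      rw [← Complex.exp_add]; simp
    simp only [hD, hL]
    rw [mul_pow, Complex.I_sq]
    linear_combination 4 * v * this
  have ii : ∀ k : ℕ, IntervalIntegrable (fun x => L x ^ k) MeasureTheory.volume (-Real.pi) Real.pi :=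
    fun k => (hc.pow k).intervalIntegrable _ _
  refine ⟨by simp; ring, ?_, ?_⟩
  · have := intervalIntegral.integral_eq_sub_of_hasDerivAt (a := -Real.pi) (b := Real.pi) (f := D)
      (f' := fun x => -(L x - u)) (fun x _ => dD x) ((by fun_prop : Continuous _).intervalIntegrable _ _)
    rw [hper.2, sub_self, intervalIntegral.integral_neg, intervalIntegral.integral_sub
      (hc.intervalIntegrable _ _) (by simp)] at this
    simp at this ⊢
    linear_combination -this
  · have := intervalIntegral.integral_eq_sub_of_hasDerivAt (a := -Real.pi) (b := Real.pi)
      (f := fun x => L x ^ (n+1) * D x)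
      (f' := fun x => -((n:ℂ)+2) * L x ^ (n+2) + (2*(n:ℂ)+3) * u * L x ^ (n+1)
        + ((n:ℂ)+1) * (4*v-u^2) * L x ^ n) (fun x _ => by
          refine (((dL x).pow (n+1)).mul (dD x)).congr_deriv ?_
          push_cast
          simp only [Pi.pow_apply]
          linear_combination ((n+1) * L x ^ n) * D2 x) ((by fun_prop : Continuous _).intervalIntegrable _ _)
    rw [intervalIntegral.integral_add (((ii _).const_mul _).add ((ii _).const_mul _)) ((ii _).const_mul _),
      intervalIntegral.integral_add ((ii _).const_mul _) ((ii _).const_mul _)] at this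
    simp only [intervalIntegral.integral_const_mul, hper.1, hper.2, sub_self] at this
    linear_combination -this

lemma coeff_integral (p : Polynomial ℂ) (s : ℕ) :
    (∫ ψ in (-(Real.pi/2))..(Real.pi/2), Complex.exp (-(2 * s * Complex.I * ψ)) *
      p.eval (Complex.exp (2 * Complex.I * ψ))) = Real.pi * p.coeff s := by
  have hk : ∀ k : ℕ, (∫ ψ in (-(Real.pi/2))..(Real.pi/2), Complex.exp (-(2 * s * Complex.I * ψ)) *
      Complex.exp (2 * Complex.I * ψ) ^ k) = if k = s then (Real.pi : ℂ) else 0 := by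
    intro k
    have e : ∀ ψ : ℝ, Complex.exp (-(2 * s * Complex.I * ψ)) *
      Complex.exp (2 * Complex.I * ψ) ^ k = Complex.exp ((2 * Complex.I * ((k:ℂ) - s)) * ψ) := by
      intro ψ
      rw [← Complex.exp_nat_mul, ← Complex.exp_add]; congr 1; ring
    simp only [e]
    split_ifs with h
    · subst h; simp
    · have h1 : (k:ℂ) - s ≠ 0 := sub_ne_zero.mpr (by exact_mod_cast h)
      have hne : 2 * Complex.I * ((k:ℂ) - s) ≠ 0 := by
        simp [h1, Complex.I_ne_zero]
      rw [integral_exp_mul_complex hne, div_eq_zero_iff]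
      left
      rw [sub_eq_zero, Complex.exp_eq_exp_iff_exists_int]
      refine ⟨(k:ℤ) - s, ?_⟩
      push_cast; ring
  have : ∀ ψ : ℝ, Complex.exp (-(2 * s * Complex.I * ψ)) *
      p.eval (Complex.exp (2 * Complex.I * ψ)) = ∑ k ∈ Finset.range (p.natDegree + 1), p.coeff k *
        (Complex.exp (-(2 * s * Complex.I * ψ)) * Complex.exp (2 * Complex.I * ψ) ^ k) := by
    intro ψ
    rw [Polynomial.eval_eq_sum_range, Finset.mul_sum]
    refine Finset.sum_congr rfl fun k _ => by ring
  simp only [this]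
  rw [intervalIntegral.integral_finsetSum]
  · simp only [intervalIntegral.integral_const_mul, hk]
    simp only [mul_ite, mul_zero, Finset.sum_ite_eq', Finset.mem_range]
    split_ifs with h
    · ring
    · rw [Polynomial.coeff_eq_zero_of_natDegree_lt (by omega), mul_zero]
  · intro k _
    exact (by fun_prop : Continuous _).intervalIntegrable _ _

lemma PP_eval (ψ : ℝ) (r : ℕ) :
    (∫ φ in (-Real.pi)..Real.pi, JJ (ψ, φ) ^ r) * Complex.exp (r * (Complex.I * ψ)) =
      2 * Real.pi * (PP r).eval (Complex.exp (2 * Complex.I * ψ)) := by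
  set E := Complex.exp (Complex.I * ψ) with hE
  have hE2 : Complex.exp (2 * Complex.I * ψ) = E ^ 2 := by
    rw [hE, ← Complex.exp_nat_mul]; congr 1; push_cast; ring
  have hEn : ∀ r : ℕ, Complex.exp (r * (Complex.I * ψ)) = E ^ r := fun r => by
    rw [hE, ← Complex.exp_nat_mul]
  rw [hE2, hEn]
  have hEi : Complex.exp (-(Complex.I * ψ)) = E⁻¹ := Complex.exp_neg _
  have hE0 : E ≠ 0 := Complex.exp_ne_zero _
  have hu : 1 + E ^ 2 = E * (2 * Complex.cos ψ) := by
    rw [Complex.two_cos, mul_comm (ψ:ℂ), neg_mul, mul_comm (ψ:ℂ), ← hE, hEi]; field_simp; ring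
  have hd : (1 - E^2)^2 = E^2 * (4 * Complex.cos (2 * ψ) - (2 * Complex.cos ψ)^2) := by
    rw [Complex.cos_two_mul]
    linear_combination (1 + E^2 + E * (2 * Complex.cos ψ)) * hu
  have hM := M_rec (2 * Complex.cos ψ) (Complex.cos (2 * ψ)) (fun φ : ℝ => JJ (ψ, φ)) (by
    funext φ; simp only [JJ])
  refine rec_unique (m := fun r => (∫ φ in (-Real.pi)..Real.pi, JJ (ψ, φ) ^ r) * E ^ r)
    (k := fun r => 2 * Real.pi * (PP r).eval (E ^ 2)) (u := 1 + E^2) (d := (1 - E^2)^2)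
    ?_ ?_ ?_ ?_ r
  · simp only [(hM 0).1]; simp [PP]
  · simp only [(hM 0).2.1]; simp [PP]; rw [hu]; ring
  · intro n
    have := (hM n).2.2
    rw [hu, hd]
    linear_combination E^(n+2) * this
  · intro n
    have := PP_rec n (E^2)
    linear_combination 2 * Real.pi * this

def BoxS : Set (ℝ × ℝ) := Set.Ioc (-(Real.pi/2)) (Real.pi/2) ×ˢ Set.Ioc (-Real.pi) Real.pi

lemma box_int (f : ℝ × ℝ → ℂ) (hf : Continuous f) : MeasureTheory.IntegrableOn f BoxS := by
  have hK : IsCompact (Set.Icc (-(Real.pi/2)) (Real.pi/2) ×ˢ Set.Icc (-Real.pi) Real.pi) :=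
    isCompact_Icc.prod isCompact_Icc
  exact (hf.continuousOn.integrableOn_compact hK).mono_set
    (Set.prod_mono Set.Ioc_subset_Icc_self Set.Ioc_subset_Icc_self)

lemma coeff_box (p : Polynomial ℂ) (s : ℕ) (f : ℝ × ℝ → ℂ) (hf : Continuous f)
    (h : ∀ ψ : ℝ, ∫ φ in (-Real.pi)..Real.pi, f (ψ, φ) = Complex.exp (-(2 * s * Complex.I * ψ)) *
      (2 * Real.pi * p.eval (Complex.exp (2 * Complex.I * ψ)))) :
    ∫ z in BoxS, f z = 2 * Real.pi ^ 2 * p.coeff s := by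
  have hpi := Real.pi_pos
  have := MeasureTheory.setIntegral_prod (μ := MeasureTheory.volume) (ν := MeasureTheory.volume) f (box_int f hf)
  rw [BoxS, MeasureTheory.Measure.volume_eq_prod, this, ← intervalIntegral.integral_of_le (by linarith)]
  simp only [← intervalIntegral.integral_of_le (show -Real.pi ≤ Real.pi by linarith), h]
  have e : ∀ ψ : ℝ, Complex.exp (-(2 * s * Complex.I * ψ)) *
      (2 * Real.pi * p.eval (Complex.exp (2 * Complex.I * ψ))) = (2 * Real.pi) *
      (Complex.exp (-(2 * s * Complex.I * ψ)) * p.eval (Complex.exp (2 * Complex.I * ψ))) := fun ψ => by ring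
  simp only [e]
  rw [intervalIntegral.integral_const_mul, coeff_integral]; ring

lemma coeffP (s : ℕ) (hs : 1 ≤ s) :
    ∫ z in BoxS, JJ z ^ (2*s-1) * JJ z = 2 * Real.pi ^ 2 * (PP (2*s)).coeff s := by
  refine coeff_box _ _ _ ((JJ_continuous.pow _).mul JJ_continuous) fun ψ => ?_
  have e : ∀ z, JJ z ^ (2*s-1) * JJ z = JJ z ^ (2 * s) := fun z => by
    rw [← pow_succ]; congr 1; omega
  simp only [e]
  have hexp : Complex.exp (-(2 * s * Complex.I * ψ)) * Complex.exp (((2*s : ℕ):ℂ) * (Complex.I * ψ)) = 1 := by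
    rw [← Complex.exp_add, ← Complex.exp_zero]; congr 1; push_cast; ring
  rw [← PP_eval]
  linear_combination -(∫ φ in (-Real.pi)..Real.pi, JJ (ψ, φ) ^ (2*s)) * hexp

noncomputable def QQ (r : ℕ) : Polynomial ℂ := PP r - (1 + Polynomial.X) * PP (r-1)

lemma coeffQ (s : ℕ) (hs : 1 ≤ s) :
    ∫ z in BoxS, JJ z ^ (2*s-1) * (JJ z - 2 * Complex.cos z.1) = 2 * Real.pi ^ 2 * (QQ (2*s)).coeff s := by
  refine coeff_box _ _ _ ((JJ_continuous.pow _).mul (JJ_continuous.sub (by fun_prop))) fun ψ => ?_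
  have e : ∀ φ : ℝ, JJ (ψ,φ) ^ (2*s-1) * (JJ (ψ,φ) - 2 * Complex.cos ψ)
     = JJ (ψ,φ) ^ (2 * s) - 2 * Complex.cos ψ * JJ (ψ,φ) ^ (2*s-1) := fun z => by
    rw [mul_sub, ← pow_succ, mul_comm (JJ _ ^ _) (2 * _)]; congr 2; omega
  have hc : Continuous fun φ : ℝ => JJ (ψ, φ) := JJ_continuous.comp (by fun_prop)
  simp only [e]
  have hi : ∀ k : ℕ, IntervalIntegrable (fun φ : ℝ => JJ (ψ, φ) ^ k) MeasureTheory.volume (-Real.pi) Real.pi :=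
    fun k => (hc.pow k).intervalIntegrable _ _
  rw [intervalIntegral.integral_sub (hi _) ((hi _).const_mul _), intervalIntegral.integral_const_mul]
  have h1 := PP_eval ψ (2*s)
  have h2 := PP_eval ψ (2*s-1)
  have hexp : Complex.exp (-(2 * s * Complex.I * ψ)) * Complex.exp (2 * s * Complex.I * ψ) = 1 := by
    rw [← Complex.exp_add]; simp
  have h3 : Complex.exp (((2*s : ℕ):ℂ) * (Complex.I * ψ)) = Complex.exp (2 * s * Complex.I * ψ) := by
    congr 1; push_cast; ring
  have h4 : (1 + Complex.exp (2 * Complex.I * ψ)) * Complex.exp (((2*s-1 : ℕ):ℂ) * (Complex.I * ψ))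
     = 2 * Complex.cos ψ * Complex.exp (2 * s * Complex.I * ψ) := by
    rw [Complex.two_cos, add_mul, add_mul, ← Complex.exp_add, ← Complex.exp_add, ← Complex.exp_add,
      Nat.cast_sub (by omega), add_comm, one_mul]
    push_cast
    congr 2 <;> ring
  simp only [QQ, Polynomial.eval_sub, Polynomial.eval_mul, Polynomial.eval_add, Polynomial.eval_one, Polynomial.eval_X]
  rw [h3] at h1
  linear_combination (Complex.exp (-(2 * s * Complex.I * ψ))) * h1
     - (Complex.exp (-(2 * s * Complex.I * ψ))) * (1 + Complex.exp (2 * Complex.I * ψ)) * h2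
     + Complex.exp (-(2 * s * Complex.I * ψ)) * (∫ φ in (-Real.pi)..Real.pi, JJ (ψ, φ) ^ (2*s-1)) * h4
     - ((∫ φ in (-Real.pi)..Real.pi, JJ (ψ, φ) ^ (2*s)) - 2 * Complex.cos ψ *
       (∫ φ in (-Real.pi)..Real.pi, JJ (ψ, φ) ^ (2*s-1))) * hexp

lemma JJ_eq (z : ℝ × ℝ) : JJ z = ((2 * Real.cos z.1 + 2 * Real.cos z.1 ^ 2 * Real.cos z.2 : ℝ) : ℂ)
    + ((-2 * (1 - Real.cos z.1 ^ 2) * Real.sin z.2 : ℝ) : ℂ) * Complex.I := by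
  unfold JJ
  rw [mul_comm Complex.I, ← neg_mul, Complex.exp_mul_I, Complex.exp_mul_I,
    Complex.cos_neg, Complex.sin_neg, Complex.cos_two_mul]
  push_cast
  ring

lemma poly_ineq (C c : ℝ) (h0 : 0 ≤ C) (h1 : C ≤ 1) (h2 : -1 ≤ c) (h3 : c ≤ 1) :
    (C + C^2*c)^2 + (1-C^2)^2*(1-c^2) ≤ 2 + C + c := by
  have hA : 0 ≤ (1-2*C^2)*c^2 + (1-2*C^3)*c + (1+C+C^2-C^4) := by
    have hC2 : C^2 ≤ 1 := by nlinarith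
    have hC3 : C^3 ≤ 1 := pow_le_one₀ h0 h1
    have hC3' : 0 ≤ C^3 := by positivity
    have hC4 : C^4 ≤ C^2 := pow_le_pow_of_le_one h0 h1 (by norm_num)
    rcases le_total 0 (1-2*C^2) with hp | hp
    · have : -1 ≤ (1-2*C^3)*c := by
        have : |(1-2*C^3)*c| ≤ 1 := by
          rw [abs_mul]
          exact mul_le_one₀ (abs_le.mpr ⟨by linarith, by linarith⟩) (abs_nonneg _) (abs_le.mpr ⟨h2, h3⟩)
        exact (abs_le.mp this).1
      have := mul_nonneg hp (sq_nonneg c)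
      linarith
    · have e1 : 0 ≤ (1+c) * ((1-C)*(3+4*C+3*C^2+C^3)) :=
        mul_nonneg (by linarith) (mul_nonneg (by linarith) (by positivity))
      have e2 : 0 ≤ (1-c) * (1+C*(1-C)+C^3*(2-C)) :=
        mul_nonneg (by linarith) (add_nonneg (add_nonneg zero_le_one (mul_nonneg h0 (by linarith)))
          (mul_nonneg hC3' (by linarith)))
      have e3 : 0 ≤ -(1-2*C^2) * ((1-c)*(1+c)) :=
        mul_nonneg (by linarith) (mul_nonneg (by linarith) (by linarith))
      nlinarith
  nlinarith

lemma JJ_bound (z : ℝ × ℝ) (h1 : |z.1| ≤ Real.pi/2) (h2 : |z.2| ≤ Real.pi) :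
    ‖JJ z / 4‖ ^ 2 ≤ Real.exp (-(z.1^2 + z.2^2) / (2*Real.pi^2)) := by
  have hpi := Real.pi_pos
  have hC0 : 0 ≤ Real.cos z.1 := Real.cos_nonneg_of_mem_Icc (by rw [abs_le] at h1; exact ⟨by linarith [h1.1], h1.2⟩)
  have hp := poly_ineq (Real.cos z.1) (Real.cos z.2) hC0 (Real.cos_le_one _) (Real.neg_one_le_cos _) (Real.cos_le_one _)
  have e : ‖JJ z / 4‖ ^ 2 = ((Real.cos z.1 + Real.cos z.1^2*Real.cos z.2)^2 + (1-Real.cos z.1^2)^2*(1-Real.cos z.2^2)) / 4 := by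
    rw [norm_div, div_pow, JJ_eq, Complex.sq_norm, Complex.normSq_add_mul_I, ← Real.sin_sq (z.1), ← Real.sin_sq]
    norm_num
    ring
  rw [e]
  have b1 := Real.cos_le_one_sub_mul_cos_sq (x := z.1) (by linarith)
  have b2 := Real.cos_le_one_sub_mul_cos_sq h2
  have : (-(z.1^2 + z.2^2) / (2*Real.pi^2)) + 1 = (4 - 2/Real.pi^2 * z.1^2 - 2/Real.pi^2*z.2^2)/4 := by
    field_simp; ring
  refine le_trans ?_ (Real.add_one_le_exp _)
  rw [this]
  linarith

lemma lim_cos (a : ℝ) : Tendsto (fun s : ℕ => (s:ℝ) * (1 - Real.cos ((√s)⁻¹ * a))) atTop (𝓝 (a^2/2)) := by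
  have hx : Tendsto (fun s : ℕ => (√(s:ℝ))⁻¹) atTop (𝓝 0) :=
    (Real.tendsto_sqrt_atTop.comp tendsto_natCast_atTop_atTop).inv_tendsto_atTop
  have hs : Tendsto (fun s : ℕ => (a^2/2) * Real.sinc ((√(s:ℝ))⁻¹ * a / 2)^2) atTop (𝓝 ((a^2/2) * Real.sinc (0 * a / 2)^2)) := by
    exact (((Real.continuous_sinc.tendsto _).comp ((hx.mul_const a).div_const 2)).pow 2).const_mul _
  simp only [zero_mul, zero_div, Real.sinc_zero, one_pow, mul_one] at hs
  refine hs.congr' ?_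
  filter_upwards [eventually_gt_atTop 0] with s hs
  have hs' : (0:ℝ) < s := by exact_mod_cast hs
  have hq : √(s:ℝ) ≠ 0 := (Real.sqrt_pos.mpr hs').ne'
  have hq2 : √(s:ℝ)^2 = s := Real.sq_sqrt hs'.le
  have hc : Real.cos ((√s)⁻¹ * a) = 1 - 2 * Real.sin ((√s)⁻¹ * a / 2)^2 := by
    rw [← Real.cos_sq_add_sin_sq ((√s)⁻¹ * a / 2)]
    conv_lhs => rw [show (√s)⁻¹ * a = 2 * ((√s)⁻¹ * a / 2) by ring, Real.cos_two_mul]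
    linarith [Real.cos_sq_add_sin_sq ((√s)⁻¹ * a / 2)]
  rw [hc]
  by_cases ha : a = 0
  · simp [ha]
  rw [Real.sinc_of_ne_zero (by positivity)]
  field_simp
  rw [hq2]; ring

lemma lim_J (w : ℝ × ℝ) : Tendsto (fun s : ℕ => (JJ ((√(s:ℝ))⁻¹ • w) / 4) ^ (2*s-1)) atTop
    (𝓝 (Real.exp (-(3/2) * w.1^2) * Real.exp (-(1/2) * w.2^2) : ℝ)) := by
  obtain ⟨a, b⟩ := w
  have hx : Tendsto (fun s : ℕ => (√(s:ℝ))⁻¹) atTop (𝓝 0) :=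
    (Real.tendsto_sqrt_atTop.comp tendsto_natCast_atTop_atTop).inv_tendsto_atTop
  have hC : Tendsto (fun s : ℕ => Real.cos ((√(s:ℝ))⁻¹ * a)) atTop (𝓝 1) := by
    have := (Real.continuous_cos.tendsto _).comp (hx.mul_const a)
    simpa [Function.comp_def] using this
  have hS : Tendsto (fun s : ℕ => Real.sin ((√(s:ℝ))⁻¹ * b)) atTop (𝓝 0) := by
    have := (Real.continuous_sin.tendsto _).comp (hx.mul_const b)
    simpa [Function.comp_def] using this
  have la := lim_cos a
  have lb := lim_cos b
  set z : ℕ → ℂ := fun s => JJ ((√(s:ℝ))⁻¹ • (a,b)) / 4 with hz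
  have hg : Tendsto (fun s : ℕ => (s:ℂ) * (z s - 1)) atTop (𝓝 ((-(3*a^2 + b^2)/4 : ℝ) : ℂ)) := by
    have r1 : Tendsto (fun s : ℕ => (-( (s:ℝ) * (1 - Real.cos ((√s)⁻¹ * a))) - Real.cos ((√s)⁻¹ * a)^2 * ((s:ℝ) * (1 - Real.cos ((√s)⁻¹ * b)))
        - ((s:ℝ) * (1 - Real.cos ((√s)⁻¹ * a))) * (1 + Real.cos ((√s)⁻¹ * a)))/2) atTop
        (𝓝 ((-(a^2/2) - 1^2 * (b^2/2) - (a^2/2)*(1+1))/2)) :=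
      ((la.neg.sub ((hC.pow 2).mul lb)).sub (la.mul (hC.const_add 1))).div_const 2
    have r2 : Tendsto (fun s : ℕ => -(((s:ℝ) * (1 - Real.cos ((√s)⁻¹ * a))) * (1 + Real.cos ((√s)⁻¹ * a)) * Real.sin ((√s)⁻¹ * b))/2) atTop
        (𝓝 (-((a^2/2)*(1+1)*0)/2)) :=
      (((la.mul (hC.const_add 1)).mul hS).neg).div_const 2
    have c1 := (Complex.continuous_ofReal.tendsto _).comp r1
    have c2 := ((Complex.continuous_ofReal.tendsto _).comp r2).mul_const Complex.I
    have c3 := c1.add c2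
    convert c3 using 1
    · funext s
      simp only [hz, JJ_eq, Function.comp, Prod.smul_mk, smul_eq_mul]
      push_cast
      ring
    · congr 1
      push_cast; ring
  have hp := Complex.tendsto_one_add_pow_exp_of_tendsto hg
  have hz1 : Tendsto z atTop (𝓝 1) := by
    have h0 : Tendsto (fun s : ℕ => (√(s:ℝ))⁻¹ • ((a,b) : ℝ × ℝ)) atTop (𝓝 ((0:ℝ) • (a,b))) := hx.smul_const _
    have := ((JJ_continuous.tendsto _).comp h0).div_const 4
    have e : JJ ((0:ℝ) • (a,b)) / 4 = 1 := by simp [JJ]; norm_num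
    rw [e] at this
    exact this
  have hfin := (hp.pow 2).div hz1 one_ne_zero
  have e : Complex.exp ((-(3*a^2 + b^2)/4 : ℝ) : ℂ) ^ 2 / 1 = (Real.exp (-(3/2) * a^2) * Real.exp (-(1/2) * b^2) : ℝ) := by
    rw [← Real.exp_add, div_one, ← Complex.exp_nat_mul, Complex.ofReal_exp]
    congr 1; push_cast; ring
  rw [e] at hfin
  refine hfin.congr' ?_
  filter_upwards [eventually_gt_atTop 0, hz1.eventually_ne one_ne_zero] with s hs hne
  simp only [add_sub_cancel, Pi.div_apply]
  rw [div_eq_iff hne, ← pow_succ, ← pow_mul]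
  congr 1; omega

open MeasureTheory in
lemma asym (g : ℝ × ℝ → ℂ) (hg : Continuous g) (B : ℝ) (hB : ∀ z, ‖g z‖ ≤ B) :
    Tendsto (fun s : ℕ => (s:ℂ) * ∫ z in BoxS, (JJ z / 4) ^ (2*s-1) * g z) atTop
      (𝓝 ((2 * Real.pi / √3 : ℝ) * g (0,0))) := by
  have hpi := Real.pi_pos
  have hB0 : 0 ≤ B := (norm_nonneg _).trans (hB 0)
  have hBm : MeasurableSet BoxS := measurableSet_Ioc.prod measurableSet_Ioc
  have hx : Tendsto (fun s : ℕ => (√(s:ℝ))⁻¹) atTop (𝓝 0) :=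
    (Real.tendsto_sqrt_atTop.comp tendsto_natCast_atTop_atTop).inv_tendsto_atTop
  set f : ℕ → ℝ × ℝ → ℂ := fun s => BoxS.indicator fun z => (JJ z / 4) ^ (2*s-1) * g z with hf
  have e1 : ∀ᶠ s : ℕ in atTop, ∫ w, f s ((√(s:ℝ))⁻¹ • w) = (s:ℂ) * ∫ z in BoxS, (JJ z / 4) ^ (2*s-1) * g z := by
    filter_upwards [eventually_gt_atTop 0] with s hs
    have hs' : (0:ℝ) < s := by exact_mod_cast hs
    rw [Measure.integral_comp_smul, ← integral_indicator hBm]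
    simp only [Module.finrank_prod, Module.finrank_self, one_add_one_eq_two]
    rw [inv_pow, Real.sq_sqrt hs'.le, inv_inv, abs_of_pos hs', Complex.real_smul]
    simp [hf]
  set bound : ℝ × ℝ → ℝ := fun w => B * (Real.exp (-(1/(4*Real.pi^2)) * w.1^2) * Real.exp (-(1/(4*Real.pi^2)) * w.2^2)) with hbd
  have hbi : Integrable bound := by
    have := integrable_exp_neg_mul_sq (b := 1/(4*Real.pi^2)) (by positivity)
    exact (this.mul_prod this).const_mul B
  have hlim : Tendsto (fun s : ℕ => ∫ w, f s ((√(s:ℝ))⁻¹ • w)) atTop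
     (𝓝 (∫ w : ℝ × ℝ, ((Real.exp (-(3/2) * w.1^2) * Real.exp (-(1/2) * w.2^2) : ℝ) : ℂ) * g (0,0))) := by
    refine tendsto_integral_filter_of_dominated_convergence bound ?_ ?_ hbi ?_
    · refine Eventually.of_forall fun s => ?_
      have m1 : Measurable (f s) :=
        (((JJ_continuous.div_const 4).pow _).mul hg).measurable.indicator hBm
      exact (m1.comp (measurable_const_smul _)).aestronglyMeasurable
    · filter_upwards [eventually_gt_atTop 0] with s hs
      refine Eventually.of_forall fun w => ?_
      have hs' : (0:ℝ) < s := by exact_mod_cast hs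
      have hq2 : √(s:ℝ)^2 = s := Real.sq_sqrt hs'.le
      have hbn : 0 ≤ bound w := by simp only [hbd]; positivity
      by_cases hm : (√(s:ℝ))⁻¹ • w ∈ BoxS
      · simp only [hf, Set.indicator_of_mem hm]
        have hJ := JJ_bound ((√(s:ℝ))⁻¹ • w) (abs_le.mpr ⟨hm.1.1.le, hm.1.2⟩) (abs_le.mpr ⟨hm.2.1.le, hm.2.2⟩)
        set n := ‖JJ ((√(s:ℝ))⁻¹ • w) / 4‖ with hn
        have hn0 : 0 ≤ n := norm_nonneg _
        have hn1 : n ≤ 1 := by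
          have : n^2 ≤ 1 := hJ.trans (Real.exp_le_one_iff.mpr (by
            apply div_nonpos_of_nonpos_of_nonneg
            · nlinarith [sq_nonneg ((√(s:ℝ))⁻¹ • w).1, sq_nonneg ((√(s:ℝ))⁻¹ • w).2]
            · positivity))
          nlinarith
        have h1 : n ^ (2*s-1) ≤ n ^ s := pow_le_pow_of_le_one hn0 hn1 (by omega)
        have h2 : (n^s) ≤ Real.exp (-(1/(4*Real.pi^2)) * w.1^2) * Real.exp (-(1/(4*Real.pi^2)) * w.2^2) := by
          refine le_of_sq_le_sq ?_ (by positivity)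
          calc (n^s)^2 = (n^2)^s := by ring
            _ ≤ _ := pow_le_pow_left₀ (by positivity) hJ s
            _ = _ := by
              rw [← Real.exp_add, ← Real.exp_nat_mul, ← Real.exp_nat_mul]
              congr 1
              simp only [Prod.smul_fst, Prod.smul_snd, smul_eq_mul, mul_pow, inv_pow, hq2]
              push_cast
              field_simp
              ring
        rw [norm_mul, norm_pow, ← hn, mul_comm]
        exact mul_le_mul (hB _) (h1.trans h2) (by positivity) hB0
      · simp only [hf, Set.indicator_of_notMem hm, norm_zero]; exact hbn
    · refine Eventually.of_forall fun w => ?_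
      have h0 : Tendsto (fun s : ℕ => (√(s:ℝ))⁻¹ • w) atTop (𝓝 (0,0)) := by
        have := hx.smul_const w
        rw [zero_smul] at this
        exact this
      have hbox : BoxS ∈ 𝓝 ((0,0) : ℝ × ℝ) :=
        prod_mem_nhds (Ioc_mem_nhds (by linarith) (by linarith)) (Ioc_mem_nhds (by linarith) (by linarith))
      refine ((lim_J w).mul ((hg.tendsto _).comp h0)).congr' ?_
      filter_upwards [h0.eventually hbox] with s hs
      simp only [hf, Function.comp]
      have hs' : (√(s:ℝ))⁻¹ • w ∈ BoxS := hs
      rw [Set.indicator_of_mem hs']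
  have hval : (∫ w : ℝ × ℝ, ((Real.exp (-(3/2) * w.1^2) * Real.exp (-(1/2) * w.2^2) : ℝ) : ℂ) * g (0,0))
      = (2 * Real.pi / √3 : ℝ) * g (0,0) := by
    rw [integral_mul_const, integral_complex_ofReal, Measure.volume_eq_prod,
      integral_prod_mul (fun x : ℝ => Real.exp (-(3/2) * x^2)) (fun x : ℝ => Real.exp (-(1/2) * x^2)),
      integral_gaussian, integral_gaussian, ← Real.sqrt_mul (by positivity)]
    congr 2
    rw [show Real.pi / (3/2) * (Real.pi / (1/2)) = (2 * Real.pi)^2 / 3 by ring, Real.sqrt_div (by positivity),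
      Real.sqrt_sq (by positivity)]
  rw [hval] at hlim
  exact hlim.congr' e1

lemma coeff_lim (c : ℕ → ℂ) (g : ℝ × ℝ → ℂ) (hg : Continuous g) (B : ℝ) (hB : ∀ z, ‖g z‖ ≤ B)
    (g0 : ℝ) (hg0 : g (0,0) = g0) (hne : g0 ≠ 0)
    (h : ∀ s : ℕ, 1 ≤ s → ∫ z in BoxS, JJ z ^ (2*s-1) * (4 * g z) = 2 * Real.pi ^ 2 * c s) :
    Tendsto (fun s : ℕ => c s / ((2 * g0 * (4:ℝ)^(2*s) / (2 * (s:ℝ) * Real.pi * √3) : ℝ) : ℂ)) atTop (𝓝 1) := by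
  have hpi := Real.pi_pos
  have h3 : (√3 : ℝ) ≠ 0 := by positivity
  have h1 := (asym g hg B hB).mul_const ((√3 / (2 * Real.pi * g0) : ℝ) : ℂ)
  have e : ((2 * Real.pi / √3 : ℝ) : ℂ) * g (0,0) * ((√3 / (2 * Real.pi * g0) : ℝ) : ℂ) = 1 := by
    rw [hg0]; norm_cast; field_simp
  rw [e] at h1
  refine h1.congr' ?_
  filter_upwards [eventually_ge_atTop 1] with s hs
  have hs' : (s:ℂ) ≠ 0 := by exact_mod_cast (by omega : s ≠ 0)
  have hI : ∫ z in BoxS, JJ z ^ (2*s-1) * (4 * g z) = 4 ^ (2*s) * ∫ z in BoxS, (JJ z / 4) ^ (2*s-1) * g z := by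
    rw [← MeasureTheory.integral_const_mul]
    congr 1; funext z
    rw [div_pow]
    obtain ⟨k, rfl⟩ : ∃ k, s = k + 1 := ⟨s-1, by omega⟩
    rw [show 2*(k+1)-1 = 2*k+1 by omega, show 2*(k+1) = 2*k+1+1 by omega, pow_succ (4:ℂ) (2*k+1)]
    field_simp
  have hc := (hI.symm.trans (h s hs))
  have h4 : (4:ℂ)^(2*s) ≠ 0 := pow_ne_zero _ (by norm_num)
  have hpc : (Real.pi:ℂ) ≠ 0 := by exact_mod_cast hpi.ne'
  have h3c : ((√3:ℝ):ℂ) ≠ 0 := by exact_mod_cast h3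
  have hgc : (g0:ℂ) ≠ 0 := by exact_mod_cast hne
  push_cast
  field_simp
  linear_combination hc

lemma JJ_norm_le (z : ℝ × ℝ) : ‖JJ z - 2 * Complex.cos z.1‖ ≤ 2 ∧ ‖JJ z‖ ≤ 4 := by
  have e1 : ‖Complex.exp (-(Complex.I * z.2))‖ = 1 := by
    have := Complex.norm_exp_ofReal_mul_I (-z.2)
    rw [← this]; congr 2; push_cast; ring
  have e2 : ‖Complex.exp (Complex.I * z.2)‖ = 1 := by
    have := Complex.norm_exp_ofReal_mul_I (z.2)
    rw [← this]; congr 2; ring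
  have e3 : ∀ x : ℝ, ‖Complex.cos x‖ ≤ 1 := fun x => by
    rw [← Complex.ofReal_cos, Complex.norm_real]; exact Real.abs_cos_le_one x
  have e4 : ‖Complex.cos (2 * z.1)‖ ≤ 1 := by
    have := e3 (2 * z.1); push_cast at this; exact this
  have h1 : ‖JJ z - 2 * Complex.cos z.1‖ ≤ 2 := by
    have : JJ z - 2 * Complex.cos z.1 = Complex.exp (-(Complex.I * z.2)) + Complex.cos (2 * z.1) * Complex.exp (Complex.I * z.2) := by
      unfold JJ; ring
    rw [this]
    refine (norm_add_le _ _).trans ?_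
    rw [norm_mul, e1, e2]; linarith
  refine ⟨h1, ?_⟩
  have : JJ z = (JJ z - 2 * Complex.cos z.1) + 2 * Complex.cos z.1 := by ring
  rw [this]
  refine (norm_add_le _ _).trans ?_
  have := e3 z.1
  rw [norm_mul]
  norm_num
  linarith

lemma PP_lim : Tendsto (fun s : ℕ => (PP (2*s)).coeff s / ((2 * (4:ℝ)^(2*s) / (2 * (s:ℝ) * Real.pi * √3) : ℝ) : ℂ)) atTop (𝓝 1) := by
  have := coeff_lim (fun s => (PP (2*s)).coeff s) (fun z => JJ z / 4) (JJ_continuous.div_const 4) 1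
    (fun z => by rw [norm_div]; have := (JJ_norm_le z).2; norm_num; linarith) 1 (by simp [JJ]; norm_num) one_ne_zero
    (fun s hs => by
      rw [← coeffP s hs]; congr 1; funext z; ring)
  simpa only [mul_one] using this

lemma QQ_lim : Tendsto (fun s : ℕ => (QQ (2*s)).coeff s / (((4:ℝ)^(2*s) / (2 * (s:ℝ) * Real.pi * √3) : ℝ) : ℂ)) atTop (𝓝 1) := by
  have := coeff_lim (fun s => (QQ (2*s)).coeff s) (fun z => (JJ z - 2 * Complex.cos z.1) / 4)
    ((JJ_continuous.sub (by fun_prop)).div_const 4) 1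
    (fun z => by rw [norm_div]; have := (JJ_norm_le z).1; norm_num; linarith) (1/2) (by simp [JJ]; norm_num) (by norm_num)
    (fun s hs => by
      rw [← coeffQ s hs]; congr 1; funext z; ring)
  simpa only [show (2:ℝ) * (1/2) = 1 by norm_num, one_mul] using this

lemma transfer (R : ℕ → Polynomial ℂ) (a : ℕ → ℕ → ℂ) (T : ℕ → ℂ)
    (hR : Tendsto (fun s : ℕ => (R (2*s)).coeff s / T s) atTop (𝓝 1))
    (h : ∀ r, 1 ≤ r → ∀ᶠ y in 𝓝 (0:ℂ), (R r).eval y = ∑' s, a r s * y ^ s) :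
    Tendsto (fun s : ℕ => a (2*s) s / T s) atTop (𝓝 1) := by
  refine hR.congr' ?_
  filter_upwards [hR.eventually_ne one_ne_zero, eventually_ge_atTop 1] with s hs h1
  have hne : R (2*s) ≠ 0 := by
    intro h0; rw [h0] at hs; simp at hs
  have hne' : ((R (2*s) : Polynomial ℂ) : PowerSeries ℂ) ≠ 0 := by
    rwa [Ne, Polynomial.coe_eq_zero_iff]
  rw [coeff_of_tsum hne' (PSRep.poly (R (2*s))) (h (2*s) (by omega)) s, Polynomial.coeff_coe]

lemma outer_rep {K : ℂ → ℂ → ℂ} {b : ℕ → ℕ → ℂ} {δ : ℝ} (hδ : 0 < δ) {y : ℂ}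
    (hb : ∀ x : ℂ, ‖x‖ < δ → K x y = ∑' r : ℕ, ∑' s : ℕ, b r s * x ^ r * y ^ s)
    (hne : ∀ x : ℂ, ‖x‖ < δ → K x y ≠ 0) :
    PSRep (fun x => K x y) (PowerSeries.mk fun r => ∑' s : ℕ, b r s * y ^ s) := by
  have e : ∀ x : ℂ, ‖x‖ < δ → K x y = ∑' r : ℕ, (∑' s : ℕ, b r s * y ^ s) * x ^ r := by
    intro x hx
    rw [hb x hx]
    refine tsum_congr fun r => ?_
    rw [← tsum_mul_right]
    refine tsum_congr fun s => by ring
  have hx0 : ‖((δ/2 : ℝ) : ℂ)‖ < δ := by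
    rw [Complex.norm_real, Real.norm_eq_abs, abs_of_pos (by linarith)]; linarith
  refine PSRep.of_tsum (x₀ := ((δ/2 : ℝ) : ℂ)) (by exact_mod_cast (by positivity : δ/2 ≠ 0)) ?_ ?_
  · by_contra hns
    exact hne _ hx0 ((e _ hx0).trans (tsum_eq_zero_of_not_summable hns))
  · filter_upwards [Metric.ball_mem_nhds (0:ℂ) hδ] with x hx using e x (by simpa using hx)

/-- for `H(x,y) = 1 − 2x(1+y) − x²(1−y)²` and `G(x,y) = 1 − x(1+y)`,
the Taylor coefficients of `F = G/√H` (branch with `F(0,0) = 1`) satisfy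
`a_{2s,s} ~ 4^{2s}/(2s·π·√3)`, and those of `H^{−1/2}` (branch with value `1` at the
origin) satisfy `b_{2s,s} ~ 2·4^{2s}/(2s·π·√3)` as `s → ∞`. -/
theorem complete_graph_coloring_asymptotics
    (H G F Hp : ℂ → ℂ → ℂ) (a b : ℕ → ℕ → ℂ) (ε : ℝ) (hε : 0 < ε)
    (hH : H = fun x y => 1 - 2*x*(1+y) - x^2*(1-y)^2)
    (hG : G = fun x y => 1 - x*(1+y))
    (hFan : AnalyticAt ℂ (fun z : ℂ × ℂ => F z.1 z.2) (0, 0))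
    (hF0 : F 0 0 = 1)
    (hFsq : ∀ᶠ z : ℂ × ℂ in 𝓝 (0, 0), (F z.1 z.2) ^ 2 * H z.1 z.2 = (G z.1 z.2) ^ 2)
    (ha : ∀ x y : ℂ, ‖x‖ < ε → ‖y‖ < ε →
      F x y = ∑' r : ℕ, ∑' s : ℕ, a r s * x ^ r * y ^ s)
    (hHpan : AnalyticAt ℂ (fun z : ℂ × ℂ => Hp z.1 z.2) (0, 0))
    (hHp0 : Hp 0 0 = 1)
    (hHpsq : ∀ᶠ z : ℂ × ℂ in 𝓝 (0, 0), (Hp z.1 z.2) ^ 2 * H z.1 z.2 = 1)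
    (hb : ∀ x y : ℂ, ‖x‖ < ε → ‖y‖ < ε →
      Hp x y = ∑' r : ℕ, ∑' s : ℕ, b r s * x ^ r * y ^ s) :
    Tendsto (fun s : ℕ => a (2 * s) s /
        ((((4 : ℝ) ^ (2 * s) / (2 * (s : ℝ) * Real.pi * Real.sqrt 3) : ℝ)) : ℂ))
      atTop (𝓝 1)
    ∧ Tendsto (fun s : ℕ => b (2 * s) s /
        (((2 * (4 : ℝ) ^ (2 * s) / (2 * (s : ℝ) * Real.pi * Real.sqrt 3) : ℝ)) : ℂ))
      atTop (𝓝 1) := by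
  have hpt : ((0,0) : ℂ × ℂ) = 0 := rfl
  have cHp := hHpan.continuousAt
  have cF := hFan.continuousAt
  have cG : ContinuousAt (fun z : ℂ × ℂ => G z.1 z.2 * Hp z.1 z.2) (0,0) := by
    refine ContinuousAt.mul ?_ cHp
    rw [hG]; fun_prop
  have pos : ∀ {f : ℂ × ℂ → ℂ}, ContinuousAt f (0,0) → f (0,0) = 1 →
      ∀ᶠ z in 𝓝 ((0,0) : ℂ × ℂ), 0 < (f z).re := by
    intro f hf h1
    have : ContinuousAt (fun z => (f z).re) (0,0) := Complex.continuous_re.continuousAt.comp hf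
    exact this.eventually (lt_mem_nhds (by simp [h1]))
  have ev := (pos cHp hHp0).and ((pos cF hF0).and ((pos cG (by simp [hG, hHp0])).and (hFsq.and hHpsq)))
  obtain ⟨δ₀, hδ₀, hev⟩ := Metric.eventually_nhds_iff.mp ev
  set δ := min δ₀ ε with hδdef
  have hδ : 0 < δ := lt_min hδ₀ hε
  have main : ∀ x y : ℂ, ‖x‖ < δ → ‖y‖ < δ → 0 < (Hp x y).re ∧ 0 < (F x y).re ∧
      F x y = G x y * Hp x y ∧ (Hp x y)^2 * H x y = 1 := by
    intro x y hx hy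
    have hd : dist ((x,y) : ℂ × ℂ) (0,0) < δ₀ := by
      rw [Prod.dist_eq]
      simp only [dist_zero_right]
      exact max_lt (hx.trans_le (min_le_left _ _)) (hy.trans_le (min_le_left _ _))
    obtain ⟨h1, h2, h3, h4, h5⟩ := hev hd
    simp only at h1 h2 h3 h4 h5
    refine ⟨h1, h2, ?_, h5⟩
    have hHne : H x y ≠ 0 := by
      intro h0; rw [h0] at h5; simp at h5
    have : (F x y - G x y * Hp x y) * (F x y + G x y * Hp x y) = 0 := by
      apply mul_right_cancel₀ hHne
      linear_combination h4 - (G x y)^2 * h5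
    rcases mul_eq_zero.mp this with h | h
    · linear_combination h
    · have := congrArg Complex.re h
      simp only [Complex.add_re, Complex.zero_re] at this
      linarith
  have ne_of_re : ∀ {w : ℂ}, 0 < w.re → w ≠ 0 := by
    rintro w h rfl; simp at h
  have hball : ∀ᶠ y in 𝓝 (0:ℂ), ‖y‖ < δ := by
    filter_upwards [Metric.ball_mem_nhds (0:ℂ) hδ] with y hy using by simpa using hy
  have repB : ∀ y : ℂ, ‖y‖ < δ → PSRep (fun x => Hp x y) (PowerSeries.mk fun r => ∑' s : ℕ, b r s * y ^ s) :=
    fun y hy => outer_rep hδ (fun x hx => hb x y (hx.trans_le (min_le_right _ _)) (hy.trans_le (min_le_right _ _)))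
      (fun x hx => ne_of_re (main x y hx hy).1)
  have repA : ∀ y : ℂ, ‖y‖ < δ → PSRep (fun x => F x y) (PowerSeries.mk fun r => ∑' s : ℕ, a r s * y ^ s) :=
    fun y hy => outer_rep hδ (fun x hx => ha x y (hx.trans_le (min_le_right _ _)) (hy.trans_le (min_le_right _ _)))
      (fun x hx => ne_of_re (main x y hx hy).2.1)
  have valB : ∀ y : ℂ, ‖y‖ < δ → ∀ r : ℕ, ∑' s : ℕ, b r s * y ^ s = (PP r).eval y := by
    intro y hy
    have hrep := repB y hy
    set φ : PowerSeries ℂ := PowerSeries.mk fun r => ∑' s : ℕ, b r s * y ^ s with hφ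
    have h0 : PowerSeries.coeff 0 φ = 1 := by
      have h1 := hrep.self_of_nhds
      have h2 : HasSum (fun n => PowerSeries.coeff n φ * (0:ℂ) ^ n) (PowerSeries.coeff 0 φ) := by
        have := hasSum_single (f := fun n => PowerSeries.coeff n φ * (0:ℂ) ^ n) 0 (by
          intro n hn; simp [hn])
        simpa using this
      rw [h2.unique h1]
      obtain ⟨hr, -, -, h3⟩ := main 0 y (by simpa using hδ) hy
      simp only [hH] at h3
      have h4 : (Hp 0 y - 1) * (Hp 0 y + 1) = 0 := by linear_combination h3
      rcases mul_eq_zero.mp h4 with h | h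
      · linear_combination h
      · have := congrArg Complex.re h
        simp at this
        linarith
    have hsq : φ ^ 2 * (1 - PowerSeries.C (2*(1+y)) * PowerSeries.X - PowerSeries.C ((1-y)^2) * PowerSeries.X^2) = 1 := by
      have := ((hrep.mul hrep).mul (PSRep.poly (1 - Polynomial.C (2*(1+y)) * Polynomial.X - Polynomial.C ((1-y)^2) * Polynomial.X^2))).unique
        (PSRep.poly 1) (by
          filter_upwards [hball] with x hx
          have := (main x y hx hy).2.2.2
          simp only [hH] at this
          simp
          linear_combination this)
      simp only [Polynomial.coe_sub, Polynomial.coe_mul, Polynomial.coe_pow, Polynomial.coe_C, Polynomial.coe_X, Polynomial.coe_one] at this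
      rw [pow_two]; exact this
    obtain ⟨h1, h2⟩ := ps_rec h0 hsq
    intro r
    have := rec_unique (m := fun r => PowerSeries.coeff r φ) (k := fun r => (PP r).eval y) (u := 1 + y) (d := (1-y)^2)
      (by simp only [h0]; simp [PP]) (by simp only [h1]; simp [PP]) h2 (fun n => PP_rec n y) r
    simpa [hφ] using this
  have valA : ∀ y : ℂ, ‖y‖ < δ → ∀ r : ℕ, 1 ≤ r → ∑' s : ℕ, a r s * y ^ s = (QQ r).eval y := by
    intro y hy r hr
    have e := (repA y hy).unique ((PSRep.poly (1 - Polynomial.C (1+y) * Polynomial.X)).mul (repB y hy)) (by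
      filter_upwards [hball] with x hx
      rw [(main x y hx hy).2.2.1]
      simp [hG]; left; ring)
    obtain ⟨n, rfl⟩ : ∃ n, r = n + 1 := ⟨r-1, by omega⟩
    have e2 := congrArg (PowerSeries.coeff (n+1)) e
    simp only [Polynomial.coe_sub, Polynomial.coe_mul, Polynomial.coe_C, Polynomial.coe_X, Polynomial.coe_one,
      sub_mul, one_mul, mul_assoc, map_sub, PowerSeries.coeff_C_mul, PowerSeries.coeff_succ_X_mul, PowerSeries.coeff_mk] at e2
    rw [e2, valB y hy, valB y hy]
    simp [QQ]
  constructor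
  · exact transfer QQ a _ QQ_lim fun r hr => by
      filter_upwards [hball] with y hy using (valA y hy r hr).symm
  · exact transfer PP b _ PP_lim fun r hr => by
      filter_upwards [hball] with y hy using (valB y hy r).symm
end

section
/- Let (p,q) ∈ ℂ² with p, q ≠ 0, and let H be analytic on a neighborhood of the closed polydisc D̄ = {(x,y) : |x| ≤ |p|, |y| ≤ |q|} with (p,q) the unique zero of H in D̄ and H_x(p,q) ≠ 0. Let G be analytic in a neighborhood of q with G(q) = 0 and H(p + G(y), y) = 0 for y near q. Then for every sufficiently small θ_y > 0 there exists δ > 0 such that for every real θ with θ_y/2 ≤ |θ| ≤ θ_y, the point y = q·e^{iθ} satisfies |p + G(y)| ≥ |p| + δ. -/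
open Filter Topology

/-- if `(p,q)` is the unique zero of `H` in the closed polydisc
`{|x| ≤ |p|, |y| ≤ |q|}`, `H_x(p,q) ≠ 0`, and `G` parameterizes the zero set of `H` near
`(p,q)` (so `H(p + G(y), y) = 0` with `G(q) = 0`), then for every sufficiently small
`θ_y > 0` there is `δ > 0` with `|p + G(q·e^{iθ})| ≥ |p| + δ` whenever
`θ_y/2 ≤ |θ| ≤ θ_y`. -/
theorem uniform_clearance_away_from_critical_point
    (p q : ℂ) (hp : p ≠ 0) (hq : q ≠ 0) (H : ℂ → ℂ → ℂ) (G : ℂ → ℂ)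
    (hHan : AnalyticOnNhd ℂ (fun z : ℂ × ℂ => H z.1 z.2)
      {z : ℂ × ℂ | ‖z.1‖ ≤ ‖p‖ ∧ ‖z.2‖ ≤ ‖q‖})
    (hzero : ∀ x y : ℂ, ‖x‖ ≤ ‖p‖ → ‖y‖ ≤ ‖q‖ → (H x y = 0 ↔ (x, y) = (p, q)))
    (hHx : deriv (fun x => H x q) p ≠ 0)
    (hGan : AnalyticAt ℂ G q) (hGq : G q = 0)
    (hG : ∀ᶠ y in 𝓝 q, H (p + G y) y = 0) :
    ∃ Θ > (0 : ℝ), ∀ θy : ℝ, 0 < θy → θy ≤ Θ → ∃ δ > (0 : ℝ), ∀ θ : ℝ,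
      θy / 2 ≤ |θ| → |θ| ≤ θy →
      ‖p‖ + δ ≤ ‖p + G (q * Complex.exp (Complex.I * (θ : ℂ)))‖ := by
  have hy0 : Tendsto (fun θ : ℝ => q * Complex.exp (Complex.I * (θ : ℂ))) (𝓝 0) (𝓝 q) := by
    have hc : Continuous (fun θ : ℝ => q * Complex.exp (Complex.I * (θ : ℂ))) := by fun_prop
    simpa using hc.tendsto 0
  have hev := hy0.eventually (hGan.eventually_analyticAt.and hG)
  obtain ⟨r, hr, hball⟩ := Metric.eventually_nhds_iff.mp hev
  refine ⟨min (r / 2) 1, by positivity, fun θy hθ hθΘ => ?_⟩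
  have h1 : θy ≤ r / 2 := hθΘ.trans (min_le_left _ _)
  have h2 : θy ≤ 1 := hθΘ.trans (min_le_right _ _)
  let K : Set ℝ := {θ | θy / 2 ≤ |θ| ∧ |θ| ≤ θy}
  have hKclosed : IsClosed K :=
    (isClosed_le continuous_const continuous_abs).inter
      (isClosed_le continuous_abs continuous_const)
  have hKc : IsCompact K := by
    refine (isCompact_Icc (a := -θy) (b := θy)).of_isClosed_subset hKclosed ?_
    intro θ h
    exact abs_le.mp h.2
  have hKne : K.Nonempty := ⟨θy, by
    simp only [K, Set.mem_setOf_eq, abs_of_pos hθ]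
    constructor <;> linarith⟩
  have hK : ∀ θ ∈ K, AnalyticAt ℂ G (q * Complex.exp (Complex.I * (θ : ℂ))) ∧
      H (p + G (q * Complex.exp (Complex.I * (θ : ℂ))))
        (q * Complex.exp (Complex.I * (θ : ℂ))) = 0 := by
    intro θ h
    apply hball
    rw [Real.dist_eq, sub_zero]
    have := h.2
    linarith
  have hcont : ContinuousOn
      (fun θ : ℝ => ‖p + G (q * Complex.exp (Complex.I * (θ : ℂ)))‖) K := by
    intro θ h
    apply ContinuousAt.continuousWithinAt
    have hG1 : ContinuousAt (fun θ : ℝ => G (q * Complex.exp (Complex.I * (θ : ℂ)))) θ :=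
      ContinuousAt.comp (f := fun θ : ℝ => q * Complex.exp (Complex.I * (θ : ℂ)))
        (hK θ h).1.continuousAt (by fun_prop)
    exact (continuousAt_const.add hG1).norm
  obtain ⟨θ₀, hθ₀, hmin⟩ := hKc.exists_isMinOn hKne hcont
  have hlt : ‖p‖ < ‖p + G (q * Complex.exp (Complex.I * (θ₀ : ℂ)))‖ := by
    by_contra hle
    push Not at hle
    have hny : ‖q * Complex.exp (Complex.I * (θ₀ : ℂ))‖ ≤ ‖q‖ := by
      rw [norm_mul, Complex.norm_exp_I_mul_ofReal, mul_one]
    have heq := (hzero _ _ hle hny).mp (hK θ₀ hθ₀).2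
    have he : q * Complex.exp (Complex.I * (θ₀ : ℂ)) = q := congrArg Prod.snd heq
    have he1 : Complex.exp (Complex.I * (θ₀ : ℂ)) = 1 := by
      apply mul_left_cancel₀ hq
      rw [he, mul_one]
    have hcos : Real.cos θ₀ = 1 := by
      have := congrArg Complex.re he1
      rwa [mul_comm, Complex.exp_ofReal_mul_I_re, Complex.one_re] at this
    have hb := abs_le.mp hθ₀.2
    have hpi := Real.pi_gt_three
    have h0 : θ₀ = 0 := (Real.cos_eq_one_iff_of_lt_of_lt (by linarith [hb.1])
      (by linarith [hb.2])).mp hcos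
    have := hθ₀.1
    rw [h0, abs_zero] at this
    linarith
  refine ⟨‖p + G (q * Complex.exp (Complex.I * (θ₀ : ℂ)))‖ - ‖p‖, by linarith, ?_⟩
  intro θ ha hb
  have := isMinOn_iff.mp hmin θ ⟨ha, hb⟩
  linarith
end
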